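/- arXiv:2501.03224 — 2 statements merged into one kernel-verified Lean document; each statement's English description precedes it below -/
import Mathlib

section
/- Let A, B, C be subsets of ℝ^n such that A is convex and closed, and C is nonempty and bounded. If A is a proper subset of B, then the Minkowski sum A + C is a proper subset of B + C. -/
open Set Pointwise

/-- if `A ⊆ ℝ^n` is convex and closed, `C ⊆ ℝ^n` is nonempty and bounded,
and `A` is a proper subset of `B`, then the Minkowski sum `A + C` is a proper subset of
`B + C`. -/
theorem minkowski_add_ssubset {n : ℕ} (A B C : Set (EuclideanSpace ℝ (Fin n)))
    (hA : Convex ℝ A) (hAc : IsClosed A)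
    (hC : C.Nonempty) (hCb : Bornology.IsBounded C)
    (hAB : A ⊂ B) : A + C ⊂ B + C := by
  refine ⟨Set.add_subset_add_right hAB.1, fun hsub => ?_⟩
  obtain ⟨b, hbB, hbA⟩ := Set.exists_of_ssubset hAB
  obtain ⟨f, u, hfA, hub⟩ := geometric_hahn_banach_closed_point hA hAc hbA
  have hbdd : BddAbove (f '' C) := by
    obtain ⟨R, hR⟩ := hCb.exists_norm_le
    refine ⟨‖f‖ * R, ?_⟩
    rintro _ ⟨c, hc, rfl⟩
    exact (le_abs_self _).trans ((f.le_opNorm c).trans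
      (mul_le_mul_of_nonneg_left (hR c hc) (norm_nonneg f)))
  obtain ⟨_, ⟨c, hc, rfl⟩, hlt⟩ := exists_lt_of_lt_csSup (hC.image f)
    (show sSup (f '' C) - (f b - u) < sSup (f '' C) by linarith)
  obtain ⟨a, ha, c', hc', heq⟩ := Set.mem_add.1 (hsub (Set.add_mem_add hbB hc))
  have h1 := le_csSup hbdd (Set.mem_image_of_mem f hc')
  have h2 := congrArg f heq
  rw [map_add, map_add] at h2
  linarith [hfA a ha]
end

section
/- In ℝ⁴, let e_1, e_2, e_3, e_4 be the standard basis vectors, let e_0 := 0, and let y := (1, 1, −1, −1). Then the polytopes X := conv{e_0, e_1, e_2, e_3, e_4} and Y := conv{0, y} are compatible. -/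
open Set Pointwise

/-- Two sets `A` and `B` are *compatible* if whenever `a ∈ A`, `b ∈ B` and `a - b` is an
extreme point of the Minkowski difference `A - B`, the sum `a + b` is an extreme point of the
Minkowski sum `A + B`. -/
def Compatible {F : Type*} [NormedAddCommGroup F] [InnerProductSpace ℝ F]
    (A B : Set F) : Prop :=
  ∀ a ∈ A, ∀ b ∈ B, a - b ∈ Set.extremePoints ℝ (A - B) →
    a + b ∈ Set.extremePoints ℝ (A + B)

section Helpers

variable {F : Type*} [NormedAddCommGroup F] [InnerProductSpace ℝ F]

lemma hull_max {S : Set F} (f : F →ₗ[ℝ] ℝ) {a : F} (h : ∀ s ∈ S, s = a ∨ f s < f a) :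
    ∀ x ∈ convexHull ℝ S, x = a ∨ f x < f a := by
  have hc : Convex ℝ {x : F | x = a ∨ f x < f a} := by
    rw [convex_iff_forall_pos]
    intro x hx y hy s t hs ht hst
    simp only [mem_ofPred_eq] at hx hy ⊢
    have key : s * f a + t * f a = f a := by rw [← add_mul, hst, one_mul]
    rcases hx with rfl | hx
    · rcases hy with rfl | hy
      · left; rw [← add_smul, hst, one_smul]
      · right
        simp only [map_add, map_smul, smul_eq_mul]
        nlinarith [mul_lt_mul_of_pos_left hy ht]
    · right
      have hy' : f y ≤ f a := by
        rcases hy with rfl | hy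
        · exact le_rfl
        · exact hy.le
      simp only [map_add, map_smul, smul_eq_mul]
      nlinarith [mul_lt_mul_of_pos_left hx hs, mul_le_mul_of_nonneg_left hy' ht.le]
  exact fun x hx => convexHull_min (t := {x : F | x = a ∨ f x < f a}) h hc hx

lemma sum_extreme {S T : Set F} {a b : F} (ha : a ∈ convexHull ℝ S) (hb : b ∈ convexHull ℝ T)
    (f : F →ₗ[ℝ] ℝ) (hS : ∀ s ∈ S, s = a ∨ f s < f a) (hT : ∀ s ∈ T, s = b ∨ f s < f b) :
    a + b ∈ Set.extremePoints ℝ (convexHull ℝ S + convexHull ℝ T) := by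
  have key : ∀ z ∈ convexHull ℝ S + convexHull ℝ T, z = a + b ∨ f z < f (a + b) := by
    rintro z ⟨x, hx, y, hy, rfl⟩
    simp only [map_add]
    rcases hull_max f hS x hx with rfl | h1 <;> rcases hull_max f hT y hy with rfl | h2
    · left; rfl
    all_goals right; linarith
  refine ⟨⟨a, ha, b, hb, rfl⟩, ?_⟩
  rintro z hz w hw ⟨s, t, hs, ht, hst, h⟩
  rcases key z hz with h1 | h1
  · exact h1
  exfalso
  have h2 : f w ≤ f (a + b) := by
    rcases key w hw with rfl | h2
    · exact le_rfl
    · exact h2.le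
  have h3 := congrArg f h
  rw [map_add f (s • z), map_smul, map_smul, smul_eq_mul, smul_eq_mul] at h3
  have key : s * f (a + b) + t * f (a + b) = f (a + b) := by rw [← add_mul, hst, one_mul]
  nlinarith [mul_lt_mul_of_pos_left h1 hs, mul_le_mul_of_nonneg_left h2 ht.le]

lemma left_extreme {A B : Set F} {a b : F} (ha : a ∈ A) (hb : b ∈ B)
    (h : a - b ∈ Set.extremePoints ℝ (A - B)) : a ∈ Set.extremePoints ℝ A := by
  refine ⟨ha, ?_⟩
  rintro x hx y hy ⟨s, t, hs, ht, hst, e⟩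
  have := h.2 (sub_mem_sub hx hb) (sub_mem_sub hy hb) ⟨s, t, hs, ht, hst, by
    rw [← e, smul_sub, smul_sub, sub_add_sub_comm, ← add_smul, hst, one_smul]⟩
  exact sub_left_injective this

lemma right_extreme {A B : Set F} {a b : F} (ha : a ∈ A) (hb : b ∈ B)
    (h : a - b ∈ Set.extremePoints ℝ (A - B)) : b ∈ Set.extremePoints ℝ B := by
  refine ⟨hb, ?_⟩
  rintro x hx y hy ⟨s, t, hs, ht, hst, e⟩
  have := h.2 (sub_mem_sub ha hx) (sub_mem_sub ha hy) ⟨s, t, hs, ht, hst, by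
    rw [← e, smul_sub, smul_sub, sub_add_sub_comm, ← add_smul, hst, one_smul]⟩
  exact sub_right_injective this

end Helpers

/-- The linear functional with coefficients `p, q, r, s`. -/
noncomputable def coeffFun (p q r s : ℝ) : EuclideanSpace ℝ (Fin 4) →ₗ[ℝ] ℝ where
  toFun x := p * x 0 + q * x 1 + r * x 2 + s * x 3
  map_add' x y := by simp; ring
  map_smul' c x := by simp; ring

lemma coeffFun_apply (p q r s : ℝ) (x : EuclideanSpace ℝ (Fin 4)) :
    coeffFun p q r s x = p * x 0 + q * x 1 + r * x 2 + s * x 3 := rfl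

/-- in `ℝ⁴`, the simplex `X = conv{0, e₁, e₂, e₃, e₄}` and the segment
`Y = conv{0, y}` with `y = (1, 1, −1, −1)` are compatible polytopes. -/
theorem simplex_segment_compatible :
    Compatible
      (convexHull ℝ {(0 : EuclideanSpace ℝ (Fin 4)),
        EuclideanSpace.single 0 1, EuclideanSpace.single 1 1,
        EuclideanSpace.single 2 1, EuclideanSpace.single 3 1})
      (convexHull ℝ {(0 : EuclideanSpace ℝ (Fin 4)),
        EuclideanSpace.single 0 1 + EuclideanSpace.single 1 1
          - EuclideanSpace.single 2 1 - EuclideanSpace.single 3 1}) := by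
  intro a ha b hb h
  have ha' := extremePoints_convexHull_subset (left_extreme ha hb h)
  have hb' := extremePoints_convexHull_subset (right_extreme ha hb h)
  simp only [mem_insert_iff, mem_singleton_iff] at ha' hb'
  rcases ha' with rfl | rfl | rfl | rfl | rfl <;> rcases hb' with rfl | rfl
  · refine sum_extreme ha hb (coeffFun (-2) (-2) (-1) (-1)) ?_ ?_ <;>
      simp [coeffFun_apply] <;> norm_num
  · refine sum_extreme ha hb (coeffFun (-1) (-1) (-2) (-2)) ?_ ?_ <;>
      simp [coeffFun_apply] <;> norm_num
  · refine sum_extreme ha hb (coeffFun (10) (-10) (9) (9)) ?_ ?_ <;>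
      simp [coeffFun_apply] <;> norm_num
  · refine sum_extreme ha hb (coeffFun (1) (0) (0) (0)) ?_ ?_ <;>
      simp [coeffFun_apply] <;> norm_num
  · refine sum_extreme ha hb (coeffFun (-10) (10) (9) (9)) ?_ ?_ <;>
      simp [coeffFun_apply] <;> norm_num
  · refine sum_extreme ha hb (coeffFun (0) (1) (0) (0)) ?_ ?_ <;>
      simp [coeffFun_apply] <;> norm_num
  · refine sum_extreme ha hb (coeffFun (0) (0) (1) (0)) ?_ ?_ <;>
      simp [coeffFun_apply] <;> norm_num
  · refine sum_extreme ha hb (coeffFun (9) (9) (10) (-10)) ?_ ?_ <;>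
      simp [coeffFun_apply] <;> norm_num
  · refine sum_extreme ha hb (coeffFun (0) (0) (0) (1)) ?_ ?_ <;>
      simp [coeffFun_apply] <;> norm_num
  · refine sum_extreme ha hb (coeffFun (9) (9) (-10) (10)) ?_ ?_ <;>
      simp [coeffFun_apply] <;> norm_num
end
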